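/- Let A₁, A₂ ⊆ B ⊆ ℤ^d with A₁ and A₂ connected, and let 𝒰 ⊆ ℤ^d be such that A₁ and A₂ are separated by 𝒰 in B. Define A = A₁ ∪ {x ∈ B : there is a path with all its points in B, starting in ∂A₁, ending at x, and disjoint from 𝒰}. Then: (i) A is connected; (ii) A ∩ (A₂ ∪ ∂A₂) = ∅; (iii) ∂A ∩ B ⊆ 𝒰. -/

import Mathlib

/-- Points of `ℤ^d`. -/
abbrev Pt (d : ℕ) := Fin d → ℤ

namespace RI

variable {d : ℕ}

/-- `l¹` distance between two points (ℕ-valued). -/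
def n1 (x y : Pt d) : ℕ := ∑ j, (x j - y j).natAbs

/-- `l∞` distance between two points (ℕ-valued). -/
def ninf (x y : Pt d) : ℕ := Finset.univ.sup fun j => (x j - y j).natAbs

/-- nearest-neighbor adjacency: `‖x - y‖₁ = 1` -/
def adj (x y : Pt d) : Prop := n1 x y = 1

/-- `*`-adjacency: `‖x - y‖_∞ = 1` -/
def adjStar (x y : Pt d) : Prop := ninf x y = 1

/-- `τ` is a nearest-neighbor path of length `N`. -/
def IsPath (τ : ℕ → Pt d) (N : ℕ) : Prop := ∀ l < N, adj (τ l) (τ (l + 1))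

/-- the range of a path of length `N` -/
def pathRange (τ : ℕ → Pt d) (N : ℕ) : Set (Pt d) := τ '' {l | l ≤ N}

/-- `x` and `y` are joined by a nearest-neighbor path all of whose points lie in `U`. -/
def ConnIn (U : Set (Pt d)) (x y : Pt d) : Prop :=
  ∃ τ N, IsPath τ N ∧ τ 0 = x ∧ τ N = y ∧ ∀ l ≤ N, τ l ∈ U

/-- a set is connected: any two of its points are joined by a path inside it -/
def ConnSet (A : Set (Pt d)) : Prop := ∀ x ∈ A, ∀ y ∈ A, ConnIn A x y

/-- the connected component of `U` containing `x` -/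
def comp (U : Set (Pt d)) (x : Pt d) : Set (Pt d) := {y | ConnIn U x y}

/-- the (outer) boundary `∂K` -/
def bd (K : Set (Pt d)) : Set (Pt d) := {x | x ∉ K ∧ ∃ y ∈ K, adj x y}

/-- the `*`-boundary `∂*K` -/
def bdStar (K : Set (Pt d)) : Set (Pt d) := {x | x ∉ K ∧ ∃ y ∈ K, adjStar x y}

/-- the interior boundary `∂_int K` -/
def intBd (K : Set (Pt d)) : Set (Pt d) := {x | x ∈ K ∧ ∃ y, y ∉ K ∧ adj x y}

/-- the `l∞` diameter of a set, valued in `ℕ∞` -/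
noncomputable def diam (K : Set (Pt d)) : ℕ∞ := ⨆ x ∈ K, ⨆ y ∈ K, (ninf x y : ℕ∞)

/-- the `l¹` distance between `K` and `K'` exceeds `1` -/
def far1 (K K' : Set (Pt d)) : Prop := ∀ x ∈ K, ∀ y ∈ K', 1 < n1 x y

/-- the `l∞` distance between `K` and `K'` exceeds `1` -/
def farInf (K K' : Set (Pt d)) : Prop := ∀ x ∈ K, ∀ y ∈ K', 1 < ninf x y

/-- `d_∞(K, K') ≤ r` -/
def dInfLE (K K' : Set (Pt d)) (r : ℕ) : Prop := ∃ x ∈ K, ∃ y ∈ K', ninf x y ≤ r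

/-- `fill A`: the set of points every connected set around which inside `Aᶜ` is finite;
for `d ≥ 2` and finite `A` this is exactly the complement of the unique infinite
connected component of `Aᶜ`. -/
def fill (A : Set (Pt d)) : Set (Pt d) :=
  {z | ∀ S : Set (Pt d), z ∈ S → S ⊆ Aᶜ → ConnSet S → S.Finite}

/-- `A₁` and `A₂` are separated by `𝒰` in `B`: `d(A₁,A₂) > 1` and every path in `B`
joining `∂A₁` to `∂A₂` meets `𝒰`. -/
def SeparatedBy (A₁ A₂ 𝒰 B : Set (Pt d)) : Prop :=
  far1 A₁ A₂ ∧
  ∀ τ N, IsPath τ N → (∀ l ≤ N, τ l ∈ B) → τ 0 ∈ bd A₁ → τ N ∈ bd A₂ →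
    ∃ l ≤ N, τ l ∈ 𝒰

/-- the scales `L_κ = L₀ (80 L)^κ` -/
def Lscale (L L₀ κ : ℕ) : ℕ := L₀ * (80 * L) ^ κ

/-- the box `C_{(κ,i)} = (i L_κ + [0, L_κ)^d) ∩ ℤ^d` -/
def boxC (L L₀ κ : ℕ) (i : Pt d) : Set (Pt d) :=
  {x | ∀ j, i j * (Lscale L L₀ κ : ℤ) ≤ x j ∧
    x j < i j * (Lscale L L₀ κ : ℤ) + (Lscale L L₀ κ : ℤ)}

/-- the neighborhood `C_{(κ,i)}^l = ⋃_{‖j‖_∞ < l} C_{(κ, i+j)}` -/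
def boxCl (L L₀ κ : ℕ) (i : Pt d) (l : ℕ) : Set (Pt d) :=
  ⋃ j ∈ {j : Pt d | ∀ t, (j t).natAbs < l}, boxC L L₀ κ (i + j)

/-- the separation event `χ_{(κ,i)}(𝒰) = 1`: there are connected sets
`A₁, A₂ ⊆ C_{(κ,i)}^2` of diameter at least `L_κ / 2` separated by `𝒰` in `C_{(κ,i)}^3` -/
def chi (L L₀ κ : ℕ) (i : Pt d) (𝒰 : Set (Pt d)) : Prop :=
  ∃ A₁ A₂ : Set (Pt d), A₁ ⊆ boxCl L L₀ κ i 2 ∧ A₂ ⊆ boxCl L L₀ κ i 2 ∧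
    ConnSet A₁ ∧ ConnSet A₂ ∧
    (Lscale L L₀ κ : ℕ∞) ≤ 2 * diam A₁ ∧ (Lscale L L₀ κ : ℕ∞) ≤ 2 * diam A₂ ∧
    SeparatedBy A₁ A₂ 𝒰 (boxCl L L₀ κ i 3)

/-- the centered boxes `C^l = [-(l-1)L₀, l L₀)^d ∩ ℤ^d` -/
def boxCen (L₀ l : ℕ) : Set (Pt d) :=
  {x | ∀ j, -(((l : ℤ) - 1) * (L₀ : ℤ)) ≤ x j ∧ x j < (l : ℤ) * (L₀ : ℤ)}

/-- the separation event `χ(𝒰) = 1` for the centered boxes -/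
def chi0 (L₀ : ℕ) (𝒰 : Set (Pt d)) : Prop :=
  ∃ A₁ A₂ : Set (Pt d), A₁ ⊆ boxCen L₀ 2 ∧ A₂ ⊆ boxCen L₀ 2 ∧
    ConnSet A₁ ∧ ConnSet A₂ ∧
    (L₀ : ℕ∞) ≤ 2 * diam A₁ ∧ (L₀ : ℕ∞) ≤ 2 * diam A₂ ∧
    SeparatedBy A₁ A₂ 𝒰 (boxCen L₀ 3)

/-- `A` is `h`-avoidable in `C`: every path in `C` with endpoints outside `A` can be
modified, within `l∞` distance `h` of its range and through `Range(τ) ∪ ∂*A`,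
into a path with the same endpoints avoiding `A`. -/
def Avoidable (h : ℝ) (A C : Set (Pt d)) : Prop :=
  ∀ τ N, IsPath τ N → (∀ l ≤ N, τ l ∈ C) → τ 0 ∉ A → τ N ∉ A →
    ∃ τ' N', IsPath τ' N' ∧ τ' 0 = τ 0 ∧ τ' N' = τ N ∧
      (∀ l ≤ N', τ' l ∉ A) ∧
      (∀ l ≤ N', (∃ k ≤ N, (ninf (τ' l) (τ k) : ℝ) ≤ h) ∧
        (τ' l ∈ pathRange τ N ∨ τ' l ∈ bdStar A))

/-- a doubly infinite transient nearest-neighbor trajectory -/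
def IsTraj (w : ℤ → Pt d) : Prop :=
  (∀ l : ℤ, adj (w l) (w (l + 1))) ∧
  Filter.Tendsto (fun l : ℤ => n1 (w l) 0) Filter.cofinite Filter.atTop

/-- `k` is a cut-time of `w`: `d_∞({w(l) : l < k}, {w(l) : l > k}) > 1` -/
def CutTime (w : ℤ → Pt d) (k : ℤ) : Prop :=
  ∀ l, l < k → ∀ l', k < l' → 1 < ninf (w l) (w l')

/-- the `j`-th sausage `𝒰_j = {w(l) : n_j < l < n_{j+1}}` -/
def sausage (w : ℤ → Pt d) (n : ℕ → ℤ) (j : ℕ) : Set (Pt d) :=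
  w '' {l | n j < l ∧ l < n (j + 1)}

/-- boxes: products of integer intervals -/
def IsBox (B : Set (Pt d)) : Prop :=
  ∃ a b : Pt d, B = {x | ∀ j, a j ≤ x j ∧ x j ≤ b j}

/-- the smallest box containing `K` -/
def sbox (K : Set (Pt d)) : Set (Pt d) := ⋂₀ {B | IsBox B ∧ K ⊆ B}

/-- the closed `l∞` ball `B(x, r)` -/
def ball (x : Pt d) (r : ℕ) : Set (Pt d) := {y | ninf x y ≤ r}

/-- a skeleton: a set of indices at the finest scale satisfying the Wiener-type
spacing conditions -/
def IsSkeleton (L L₀ : ℕ) (M : Finset (Pt d)) : Prop :=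
  ∀ m₀ ∈ M,
    (∀ h : ℕ,
      {m : Pt d | m ∈ M ∧
        dInfLE (boxC L L₀ 0 m₀) (boxC L L₀ 0 m) (L * Lscale L L₀ (h + 1)) ∧
        ¬ dInfLE (boxC L L₀ 0 m₀) (boxC L L₀ 0 m) (L * Lscale L L₀ h)}.ncard
        ≤ 2 ^ (h + 1)) ∧
    ∀ m ∈ M, m ≠ m₀ → ¬ dInfLE (boxC L L₀ 0 m₀) (boxC L L₀ 0 m) (L * Lscale L L₀ 0)

theorem adj.symm {x y : Pt d} (h : adj x y) : adj y x := by
  have e : n1 y x = n1 x y :=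
    Finset.sum_congr rfl fun j _ => by rw [← Int.natAbs_neg, neg_sub]
  exact e.trans h

theorem n1_self (x : Pt d) : n1 x x = 0 := by simp [n1]

theorem ConnIn.refl {U : Set (Pt d)} {x : Pt d} (hx : x ∈ U) : ConnIn U x x :=
  ⟨fun _ => x, 0, fun l hl => absurd hl (Nat.not_lt_zero l), rfl, rfl, fun _ _ => hx⟩

/-- A path inside `U` can be prolonged by one step inside `U`. -/
theorem ConnIn.snoc {U : Set (Pt d)} {x y z : Pt d} (h : ConnIn U x y) (hyz : adj y z)
    (hz : z ∈ U) : ConnIn U x z := by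
  obtain ⟨τ, N, hτ, h0, hN, hU⟩ := h
  refine ⟨fun l => if l ≤ N then τ l else z, N + 1, fun l hl => ?_, by simp [h0], by simp,
    fun l _ => ?_⟩
  · rcases Nat.lt_succ_iff_lt_or_eq.mp hl with h | rfl
    · simpa [h.le, Nat.succ_le_of_lt h] using hτ l h
    · simpa [hN] using hyz
  · by_cases h : l ≤ N
    · simpa [h] using hU l h
    · simpa [h] using hz

/-- Induction along a path inside `U`, from its starting point. -/
theorem ConnIn.induction {U : Set (Pt d)} {x y : Pt d} (h : ConnIn U x y) (P : Pt d → Prop)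
    (base : P x) (step : ∀ u v, ConnIn U x u → P u → adj u v → v ∈ U → P v) : P y := by
  obtain ⟨τ, N, hτ, h0, hN, hU⟩ := h
  have key : ∀ l ≤ N, P (τ l) := by
    intro l
    induction l with
    | zero => intro _; rwa [h0]
    | succ l ih =>
      intro hl
      exact step (τ l) _
        ⟨τ, l, fun k hk => hτ k (by omega), h0, rfl, fun k hk => hU k (by omega)⟩
        (ih (by omega)) (hτ l hl) (hU _ hl)
  exact hN ▸ key N le_rfl

theorem ConnIn.trans {U : Set (Pt d)} {x y z : Pt d} (hxy : ConnIn U x y)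
    (hyz : ConnIn U y z) : ConnIn U x z :=
  hyz.induction (ConnIn U x) hxy fun _ _ _ hu huv hv => hu.snoc huv hv

theorem ConnIn.symm {U : Set (Pt d)} {x y : Pt d} (h : ConnIn U x y) : ConnIn U y x := by
  obtain ⟨τ, N, hτ, h0, hN, hU⟩ := h
  refine ⟨fun l => τ (N - l), N, fun l hl => ?_, by simpa using hN, by simpa using h0,
    fun l _ => hU _ (Nat.sub_le N l)⟩
  have h := (hτ (N - (l + 1)) (by omega)).symm
  rwa [show N - (l + 1) + 1 = N - l by omega] at h

theorem ConnIn.mono {U V : Set (Pt d)} (hUV : U ⊆ V) {x y : Pt d} (h : ConnIn U x y) :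
    ConnIn V x y := by
  obtain ⟨τ, N, hτ, h0, hN, hU⟩ := h
  exact ⟨τ, N, hτ, h0, hN, fun l hl => hUV (hU l hl)⟩

theorem ConnIn.left_mem {U : Set (Pt d)} {x y : Pt d} (h : ConnIn U x y) : x ∈ U := by
  obtain ⟨τ, N, -, h0, -, hU⟩ := h
  exact h0 ▸ hU 0 (Nat.zero_le N)

theorem ConnIn.right_mem {U : Set (Pt d)} {x y : Pt d} (h : ConnIn U x y) : y ∈ U :=
  h.symm.left_mem

/-- The points reachable from `∂K` by a path in `B` avoiding `𝒰`. -/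
def reach (K B 𝒰 : Set (Pt d)) : Set (Pt d) := {x | ∃ a ∈ bd K, ConnIn (B \ 𝒰) a x}

theorem setOf_path_eq_reach (K B 𝒰 : Set (Pt d)) :
    {x | x ∈ B ∧ ∃ τ N, IsPath τ N ∧ (∀ l ≤ N, τ l ∈ B) ∧
        τ 0 ∈ bd K ∧ τ N = x ∧ ∀ l ≤ N, τ l ∉ 𝒰} = reach K B 𝒰 := by
  ext x
  constructor
  · rintro ⟨-, τ, N, hτ, hB, h0, hN, hU⟩
    exact ⟨τ 0, h0, τ, N, hτ, rfl, hN, fun l hl => ⟨hB l hl, hU l hl⟩⟩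
  · rintro ⟨a, ha, h⟩
    have hx := h.right_mem.1
    obtain ⟨τ, N, hτ, h0, hN, hU⟩ := h
    exact ⟨hx, τ, N, hτ, fun l hl => (hU l hl).1, h0 ▸ ha, hN, fun l hl => (hU l hl).2⟩

theorem connSet_union_reach {K : Set (Pt d)} (hK : ConnSet K) (B 𝒰 : Set (Pt d)) :
    ConnSet (K ∪ reach K B 𝒰) := by
  have key : ∀ x ∈ K ∪ reach K B 𝒰, ∃ y ∈ K, ConnIn (K ∪ reach K B 𝒰) y x := by
    rintro x (hx | ⟨a, ha, h⟩)
    · exact ⟨x, hx, ConnIn.refl (Or.inl hx)⟩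
    · obtain ⟨-, y, hy, hay⟩ := id ha
      refine ⟨y, hy, h.induction _ ?_ ?_⟩
      · exact (ConnIn.refl (Or.inl hy)).snoc hay.symm
          (Or.inr ⟨a, ha, ConnIn.refl h.left_mem⟩)
      · intro u v hu hyu huv hv
        exact hyu.snoc huv (Or.inr ⟨a, ha, hu.snoc huv hv⟩)
  intro x hx x' hx'
  obtain ⟨y, hy, hyx⟩ := key x hx
  obtain ⟨y', hy', hyx'⟩ := key x' hx'
  exact hyx.symm.trans (((hK y hy y' hy').mono Set.subset_union_left).trans hyx')

theorem SeparatedBy.reach_notMem_bd {A₁ A₂ 𝒰 B : Set (Pt d)} (h : SeparatedBy A₁ A₂ 𝒰 B)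
    {x : Pt d} (hx : x ∈ reach A₁ B 𝒰) : x ∉ bd A₂ := by
  obtain ⟨a, ha, τ, N, hτ, rfl, rfl, hU⟩ := hx
  intro hb
  obtain ⟨l, hl, hl'⟩ := h.2 τ N hτ (fun l hl => (hU l hl).1) ha hb
  exact (hU l hl).2 hl'

theorem SeparatedBy.reach_notMem {A₁ A₂ 𝒰 B : Set (Pt d)} (h : SeparatedBy A₁ A₂ 𝒰 B)
    {x : Pt d} (hx : x ∈ reach A₁ B 𝒰) : x ∉ A₂ := by
  obtain ⟨a, ha, hax⟩ := hx
  refine hax.induction (· ∉ A₂) ?_ ?_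
  · intro ha₂
    obtain ⟨-, y, hy, hay⟩ := ha
    exact (h.1 y hy a ha₂).ne' hay.symm
  · intro u v hau hu huv _ hv
    exact h.reach_notMem_bd ⟨a, ha, hau⟩ ⟨hu, v, hv, huv⟩

theorem bd_union_reach_inter_subset (K B 𝒰 : Set (Pt d)) :
    bd (K ∪ reach K B 𝒰) ∩ B ⊆ 𝒰 := by
  rintro x ⟨⟨hx, y, hy, hxy⟩, hxB⟩
  by_contra hU
  refine hx (Or.inr ?_)
  rcases hy with hy | ⟨a, ha, hay⟩
  · exact ⟨x, ⟨fun h => hx (Or.inl h), y, hy, hxy⟩, ConnIn.refl ⟨hxB, hU⟩⟩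
  · exact ⟨a, ha, hay.snoc hxy.symm ⟨hxB, hU⟩⟩

/-- properties of the set `A` of points reachable from `∂A₁` inside `B`
avoiding `𝒰`, together with `A₁`: it is connected, disjoint from `A₂ ∪ ∂A₂`, and its
boundary inside `B` is contained in `𝒰`. -/
theorem statement17 (d : ℕ) (A₁ A₂ B 𝒰 : Set (Pt d))
    (hA1 : A₁ ⊆ B) (hA2 : A₂ ⊆ B) (hc1 : ConnSet A₁) (hc2 : ConnSet A₂)
    (hsep : SeparatedBy A₁ A₂ 𝒰 B) :
    ∀ A : Set (Pt d),
      A = A₁ ∪ {x | x ∈ B ∧ ∃ τ N, IsPath τ N ∧ (∀ l ≤ N, τ l ∈ B) ∧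
        τ 0 ∈ bd A₁ ∧ τ N = x ∧ ∀ l ≤ N, τ l ∉ 𝒰} →
      ConnSet A ∧ A ∩ (A₂ ∪ bd A₂) = ∅ ∧ bd A ∩ B ⊆ 𝒰 := by
  rintro A rfl
  rw [setOf_path_eq_reach]
  refine ⟨connSet_union_reach hc1 B 𝒰, ?_, bd_union_reach_inter_subset A₁ B 𝒰⟩
  refine Set.eq_empty_of_forall_notMem ?_
  rintro x ⟨hx | hx, hx₂ | hx₂⟩
  · have := hsep.1 x hx x hx₂
    rw [n1_self] at this
    omega
  · obtain ⟨-, y, hy, hxy⟩ := hx₂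
    exact (hsep.1 x hx y hy).ne' hxy
  · exact hsep.reach_notMem hx hx₂
  · exact hsep.reach_notMem_bd hx hx₂

end RI
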